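/- Let K be a field, q ∈ K nonzero, and n > t positive integers. Then: (a) φ*_q ∘ (id ⊗ π') ∘ Δ = α_q as maps O_q(GL_t) → O_q(GL_t)[χ̄]; (b) (φ̃*_q ⊗ id) ∘ (id ⊗ π' ⊗ id) ∘ (id ⊗ γ*_q) ∘ Γ*_q = (α_q ⊗ id) ∘ γ*_q as maps O_q(V) → O_q(GL_t)[χ̄] ⊗ O_q(V). -/

import Mathlib

open scoped TensorProduct

noncomputable section

/-- The four defining relations of the quantized coordinate ring `O_q(M_{u,v})`, as a relation
on the free algebra on generators `X_{ij}`, `(i,j) ∈ Fin u × Fin v`. -/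
inductive QMRel (K : Type) [Field K] (q : K) (u v : ℕ) :
    FreeAlgebra K (Fin u × Fin v) → FreeAlgebra K (Fin u × Fin v) → Prop
  | row {i : Fin u} {j k : Fin v} (h : j < k) :
      QMRel K q u v (FreeAlgebra.ι K (i, j) * FreeAlgebra.ι K (i, k))
        (q • (FreeAlgebra.ι K (i, k) * FreeAlgebra.ι K (i, j)))
  | col {i k : Fin u} {j : Fin v} (h : i < k) :
      QMRel K q u v (FreeAlgebra.ι K (i, j) * FreeAlgebra.ι K (k, j))
        (q • (FreeAlgebra.ι K (k, j) * FreeAlgebra.ι K (i, j)))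
  | comm {i k : Fin u} {j l : Fin v} (h1 : i < k) (h2 : l < j) :
      QMRel K q u v (FreeAlgebra.ι K (i, j) * FreeAlgebra.ι K (k, l))
        (FreeAlgebra.ι K (k, l) * FreeAlgebra.ι K (i, j))
  | quantum {i k : Fin u} {j l : Fin v} (h1 : i < k) (h2 : j < l) :
      QMRel K q u v (FreeAlgebra.ι K (i, j) * FreeAlgebra.ι K (k, l))
        (FreeAlgebra.ι K (k, l) * FreeAlgebra.ι K (i, j) +
          (q - q⁻¹) • (FreeAlgebra.ι K (i, l) * FreeAlgebra.ι K (k, j)))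

/-- The quantized coordinate ring `O_q(M_{u,v})` of `u × v` matrices. -/
abbrev OqM (K : Type) [Field K] (q : K) (u v : ℕ) :=
  RingQuot (QMRel K q u v)

/-- The canonical generators `X_{ij}` of `O_q(M_{u,v})`. -/
def Xg (K : Type) [Field K] (q : K) {u v : ℕ} (i : Fin u) (j : Fin v) : OqM K q u v :=
  RingQuot.mkAlgHom K (QMRel K q u v) (FreeAlgebra.ι K (i, j))

/-- The number of inversions (the length) of a permutation of `Fin l`. -/
def invCount {l : ℕ} (σ : Equiv.Perm (Fin l)) : ℕ :=
  (Finset.univ.filter fun p : Fin l × Fin l => p.1 < p.2 ∧ σ p.2 < σ p.1).card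

/-- The `l × l` quantum minor of `O_q(M_{u,v})` with rows `R 0, …, R (l-1)` and columns
`C 0, …, C (l-1)`:  `[R|C] = Σ_σ (-q)^{ℓ(σ)} X_{R 0, C (σ 0)} ⋯ X_{R (l-1), C (σ (l-1))}`. -/
def qMinor (K : Type) [Field K] (q : K) {u v l : ℕ} (R : Fin l → Fin u) (C : Fin l → Fin v) :
    OqM K q u v :=
  ∑ σ : Equiv.Perm (Fin l),
    ((-q) ^ invCount σ) • (List.ofFn fun i : Fin l => Xg K q (R i) (C (σ i))).prod

/-- The relations killing all `(t+1) × (t+1)` quantum minors of `O_q(M_{m,n})`. -/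
inductive DetRel (K : Type) [Field K] (q : K) (m n t : ℕ) :
    OqM K q m n → OqM K q m n → Prop
  | minor (R : Fin (t + 1) → Fin m) (C : Fin (t + 1) → Fin n)
      (hR : StrictMono R) (hC : StrictMono C) :
      DetRel K q m n t (qMinor K q R C) 0

/-- `O_q(M_{m,n}^{≤ t}) = O_q(M_{m,n}) / I_{t+1}`, the quotient by the ideal generated by all
`(t+1) × (t+1)` quantum minors. -/
abbrev OqMle (K : Type) [Field K] (q : K) (m n t : ℕ) :=
  RingQuot (DetRel K q m n t)

/-- The quotient map `O_q(M_{m,n}) → O_q(M_{m,n}^{≤ t})`. -/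
def mkle (K : Type) [Field K] (q : K) (m n t : ℕ) :
    OqM K q m n →ₐ[K] OqMle K q m n t :=
  RingQuot.mkAlgHom K (DetRel K q m n t)

/-- The two-sided ideal of a `K`-algebra `R` generated by a subset `S`, as a set. -/
def tsSpan (K : Type) [Field K] (R : Type) [Ring R] [Algebra K R] (S : Set R) : Set R :=
  (Submodule.span K {x : R | ∃ a b : R, ∃ s ∈ S, x = a * s * b} : Submodule K R)

/-- The left `H`-comodule structure map `γ* : A ⊗ B → H ⊗ (A ⊗ B)` given on pure tensors by
`γ*(a ⊗ b) = Σ S(a₁) b₋₁ ⊗ a₀ ⊗ b₀`, built from a right coaction `ρ* : A → A ⊗ H`, a left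
coaction `λ* : B → H ⊗ B`, and the antipode `S` of `H`. -/
def gammaMap (K A B H : Type) [Field K] [Ring A] [Algebra K A] [Ring B] [Algebra K B]
    [Ring H] [HopfAlgebra K H]
    (ρ : A →ₐ[K] A ⊗[K] H) (lam : B →ₐ[K] H ⊗[K] B) :
    (A ⊗[K] B) →ₗ[K] H ⊗[K] (A ⊗[K] B) :=
  (TensorProduct.map
      ((LinearMap.mul' K H).comp
        (TensorProduct.map (HopfAlgebra.antipode (R := K)) LinearMap.id))
      LinearMap.id)
    ∘ₗ (TensorProduct.tensorTensorTensorComm K H A H B).toLinearMap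
    ∘ₗ (TensorProduct.map (TensorProduct.comm K A H).toLinearMap LinearMap.id)
    ∘ₗ (TensorProduct.map ρ.toLinearMap lam.toLinearMap)

/-- The quantum determinant `d_T` of `O_q(M_t)`. -/
def qdet (K : Type) [Field K] (q : K) (t : ℕ) : OqM K q t t :=
  qMinor K q (id : Fin t → Fin t) (id : Fin t → Fin t)

/-- The relation `χ^t = d_T⁻¹` on the polynomial ring `G[χ]` (`χ` is central). -/
inductive ChiRel (G : Type) [Ring G] (t : ℕ) (dTi : G) : Polynomial G → Polynomial G → Prop
  | rel : ChiRel G t dTi (Polynomial.X ^ t) (Polynomial.C dTi)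

/-- The canonical injection `α_q : O_q(GL_t) → O_q(GL_t)[χ̄] = O_q(GL_t)[χ]/⟨χ^t - d_T⁻¹⟩`. -/
def alphaMap (K G : Type) [Field K] [Ring G] [Algebra K G] (t : ℕ) (dTi : G) :
    G →ₐ[K] RingQuot (ChiRel G t dTi) :=
  (RingQuot.mkAlgHom K (ChiRel G t dTi)).comp Polynomial.CAlgHom

/-- The element `χ̄ ∈ O_q(GL_t)[χ̄]`. -/
def chiBar (K G : Type) [Field K] [Ring G] [Algebra K G] (t : ℕ) (dTi : G) :
    RingQuot (ChiRel G t dTi) :=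
  RingQuot.mkAlgHom K (ChiRel G t dTi) Polynomial.X

open Coalgebra WithConv in
theorem comul_antipode {R C : Type*} [CommSemiring R] [Semiring C] [HopfAlgebra R C] :
    (comul (R := R) (A := C)) ∘ₗ HopfAlgebra.antipode R =
      (TensorProduct.map (HopfAlgebra.antipode R) (HopfAlgebra.antipode R)) ∘ₗ
        (TensorProduct.comm R C C).toLinearMap ∘ₗ comul := by
  let S : C →ₗ[R] C := HopfAlgebra.antipode R
  let i₁ : C →ₐ[R] C ⊗[R] C := Algebra.TensorProduct.includeLeft
  let i₂ : C →ₐ[R] C ⊗[R] C := Algebra.TensorProduct.includeRight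
  have hδ : toConv (comul (R := R) (A := C)) = toConv i₁.toLinearMap * toConv i₂.toLinearMap := by
    ext c
    rw [(ℛ R c).convMul_apply]
    simp [i₁, i₂, (ℛ R c).eq]
  have hS : toConv ((TensorProduct.map S S) ∘ₗ (TensorProduct.comm R C C).toLinearMap ∘ₗ comul) =
      toConv (i₂.toLinearMap ∘ₗ S) * toConv (i₁.toLinearMap ∘ₗ S) := by
    ext c
    rw [(ℛ R c).convMul_apply]
    simp [i₁, i₂, ← (ℛ R c).eq]
  have hcancel (i : C →ₐ[R] C ⊗[R] C) :
      toConv (i.toLinearMap ∘ₗ S) * toConv i.toLinearMap = 1 := by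
    have h := LinearMap.algHom_comp_convMul_distrib i (toConv S) (toConv LinearMap.id)
    rw [LinearMap.antipode_mul_id] at h
    apply WithConv.ofConv_injective
    refine Eq.trans h.symm ?_
    ext c
    simp [LinearMap.convOne_def]
  apply WithConv.toConv_injective
  refine (left_inv_eq_right_inv ?_ LinearMap.comul_right_inv).symm
  change toConv ((TensorProduct.map S S) ∘ₗ (TensorProduct.comm R C C).toLinearMap ∘ₗ comul) * _ = 1
  rw [hS, hδ, mul_assoc, ← mul_assoc (toConv (i₁.toLinearMap ∘ₗ S)), hcancel, one_mul, hcancel]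

theorem OqM.algHom_ext {K : Type} [Field K] {q : K} {u v : ℕ} {B : Type*} [Semiring B]
    [Algebra K B] {f g : OqM K q u v →ₐ[K] B}
    (h : ∀ i j, f (Xg K q i j) = g (Xg K q i j)) : f = g := by
  apply RingQuot.ringQuot_ext'
  apply FreeAlgebra.hom_ext
  ext ⟨i, j⟩
  exact h i j

/-- The map `a ⊗ g ⊗ h ⊗ b ↦ s(g) h ⊗ a ⊗ b`. -/
def twistMul {K : Type} [Field K] (A B : Type) [Ring A] [Algebra K A] [Ring B] [Algebra K B]
    {H : Type} [Ring H] [Algebra K H] (s : H →ₗ[K] H) :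
    (A ⊗[K] H) ⊗[K] (H ⊗[K] B) →ₗ[K] H ⊗[K] (A ⊗[K] B) :=
  (TensorProduct.map ((LinearMap.mul' K H).comp (TensorProduct.map s LinearMap.id))
      LinearMap.id)
    ∘ₗ (TensorProduct.tensorTensorTensorComm K H A H B).toLinearMap
    ∘ₗ (TensorProduct.map (TensorProduct.comm K A H).toLinearMap LinearMap.id)

section Coaction

variable {K A B H : Type} [Field K] [Ring A] [Algebra K A] [Ring B] [Algebra K B]

theorem twistMul_tmul [Ring H] [Algebra K H] (s : H →ₗ[K] H) (a : A) (g h : H) (b : B) :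
    twistMul A B s ((a ⊗ₜ g) ⊗ₜ (h ⊗ₜ b)) = (s g * h) ⊗ₜ (a ⊗ₜ b) := by
  simp [twistMul]

variable [Ring H] [HopfAlgebra K H]

theorem gammaMap_tmul (ρ : A →ₐ[K] A ⊗[K] H) (lam : B →ₐ[K] H ⊗[K] B) (a : A) (b : B) :
    gammaMap K A B H ρ lam (a ⊗ₜ b) =
      twistMul A B (HopfAlgebra.antipode K) (ρ a ⊗ₜ lam b) := rfl

/-- The antipode of `H ⊗ H` followed by the flip. -/
def flipAntipode (K H : Type) [Field K] [Ring H] [HopfAlgebra K H] : H ⊗[K] H →ₗ[K] H ⊗[K] H :=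
  (TensorProduct.map (HopfAlgebra.antipode K) (HopfAlgebra.antipode K)) ∘ₗ
    (TensorProduct.comm K H H).toLinearMap

theorem comul_twistMul (x : A ⊗[K] H) (y : H ⊗[K] B) :
    TensorProduct.map Coalgebra.comul LinearMap.id
        (twistMul A B (HopfAlgebra.antipode K) (x ⊗ₜ[K] y)) =
      twistMul A B (flipAntipode K H)
        (TensorProduct.map LinearMap.id Coalgebra.comul x ⊗ₜ[K]
          TensorProduct.map Coalgebra.comul LinearMap.id y) := by
  induction x using TensorProduct.induction_on with
  | zero => simp
  | add x₁ x₂ h₁ h₂ => simp only [TensorProduct.add_tmul, map_add, h₁, h₂]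
  | tmul a g =>
    induction y using TensorProduct.induction_on with
    | zero => simp
    | add y₁ y₂ h₁ h₂ => simp only [TensorProduct.tmul_add, map_add, h₁, h₂]
    | tmul h b =>
      have hg := LinearMap.congr_fun (comul_antipode (R := K) (C := H)) g
      simp only [LinearMap.comp_apply] at hg
      simp [twistMul_tmul, flipAntipode, hg]

theorem gammaMap_twistMul (ρ : A →ₐ[K] A ⊗[K] H) (lam : B →ₐ[K] H ⊗[K] B)
    (x : A ⊗[K] H) (y : H ⊗[K] B) :
    TensorProduct.map LinearMap.id (gammaMap K A B H ρ lam)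
        (twistMul A B (HopfAlgebra.antipode K) (x ⊗ₜ[K] y)) =
      TensorProduct.assoc K H H (A ⊗[K] B) (twistMul A B (flipAntipode K H)
        (TensorProduct.assoc K A H H (TensorProduct.map ρ.toLinearMap LinearMap.id x) ⊗ₜ[K]
          (TensorProduct.assoc K H H B).symm
            (TensorProduct.map LinearMap.id lam.toLinearMap y))) := by
  induction x using TensorProduct.induction_on with
  | zero => simp
  | add x₁ x₂ h₁ h₂ => simp only [TensorProduct.add_tmul, map_add, h₁, h₂]
  | tmul a g =>
    induction y using TensorProduct.induction_on with
    | zero => simp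
    | add y₁ y₂ h₁ h₂ => simp only [TensorProduct.tmul_add, map_add, h₁, h₂]
    | tmul h b =>
      simp only [twistMul_tmul, TensorProduct.map_tmul, gammaMap_tmul, LinearMap.id_apply,
        AlgHom.toLinearMap_apply]
      induction ρ a using TensorProduct.induction_on with
      | zero => simp
      | add x₁ x₂ h₁ h₂ =>
        simp only [TensorProduct.add_tmul, TensorProduct.tmul_add, map_add, h₁, h₂]
      | tmul a' g' =>
        induction lam b using TensorProduct.induction_on with
        | zero => simp
        | add y₁ y₂ h₁ h₂ => simp only [TensorProduct.tmul_add, map_add, h₁, h₂]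
        | tmul h' b' => simp [twistMul_tmul, flipAntipode]

theorem gammaMap_coassoc (ρ : A →ₐ[K] A ⊗[K] H) (lam : B →ₐ[K] H ⊗[K] B)
    (hρ : ∀ a, TensorProduct.map LinearMap.id Coalgebra.comul (ρ a) =
      TensorProduct.assoc K A H H (TensorProduct.map ρ.toLinearMap LinearMap.id (ρ a)))
    (hlam : ∀ b, TensorProduct.map Coalgebra.comul LinearMap.id (lam b) =
      (TensorProduct.assoc K H H B).symm
        (TensorProduct.map LinearMap.id lam.toLinearMap (lam b)))
    (v : A ⊗[K] B) :
    TensorProduct.map LinearMap.id (gammaMap K A B H ρ lam) (gammaMap K A B H ρ lam v) =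
      TensorProduct.assoc K H H (A ⊗[K] B)
        (TensorProduct.map Coalgebra.comul LinearMap.id (gammaMap K A B H ρ lam v)) := by
  induction v using TensorProduct.induction_on with
  | zero => simp
  | add x y hx hy => simp only [map_add, hx, hy]
  | tmul a b => rw [gammaMap_tmul, gammaMap_twistMul, comul_twistMul, hρ, hlam]

end Coaction

theorem rightCoaction_coassoc {K : Type} [Field K] {q : K} {n t : ℕ}
    {G : Type} [Ring G] [HopfAlgebra K G] {T : Fin t → Fin t → G}
    (hT : ∀ i j, Coalgebra.comul (R := K) (T i j) = ∑ k, T i k ⊗ₜ[K] T k j)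
    {ρ : OqM K q n t →ₐ[K] OqM K q n t ⊗[K] G}
    (hρ : ∀ i j, ρ (Xg K q i j) = ∑ k, Xg K q i k ⊗ₜ[K] T k j) (a : OqM K q n t) :
    TensorProduct.map LinearMap.id Coalgebra.comul (ρ a) =
      TensorProduct.assoc K _ G G (TensorProduct.map ρ.toLinearMap LinearMap.id (ρ a)) := by
  have h : (Algebra.TensorProduct.map (AlgHom.id K _) (Bialgebra.comulAlgHom K G)).comp ρ =
      ((Algebra.TensorProduct.assoc K K K (OqM K q n t) G G).toAlgHom.comp
        (Algebra.TensorProduct.map ρ (AlgHom.id K G))).comp ρ := by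
    refine OqM.algHom_ext fun i j => ?_
    simp [hρ, hT, TensorProduct.tmul_sum, TensorProduct.sum_tmul]
    exact Finset.sum_comm
  exact DFunLike.congr_fun h a

theorem leftCoaction_coassoc {K : Type} [Field K] {q : K} {n t : ℕ}
    {G : Type} [Ring G] [HopfAlgebra K G] {T : Fin t → Fin t → G}
    (hT : ∀ i j, Coalgebra.comul (R := K) (T i j) = ∑ k, T i k ⊗ₜ[K] T k j)
    {lam : OqM K q t n →ₐ[K] G ⊗[K] OqM K q t n}
    (hlam : ∀ i j, lam (Xg K q i j) = ∑ k, T i k ⊗ₜ[K] Xg K q k j) (b : OqM K q t n) :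
    TensorProduct.map Coalgebra.comul LinearMap.id (lam b) =
      (TensorProduct.assoc K G G _).symm
        (TensorProduct.map LinearMap.id lam.toLinearMap (lam b)) := by
  have h : (Algebra.TensorProduct.map (Bialgebra.comulAlgHom K G) (AlgHom.id K _)).comp lam =
      ((Algebra.TensorProduct.assoc K K K G G (OqM K q t n)).symm.toAlgHom.comp
        (Algebra.TensorProduct.map (AlgHom.id K G) lam)).comp lam := by
    refine OqM.algHom_ext fun i j => ?_
    simp [hlam, hT, TensorProduct.tmul_sum, TensorProduct.sum_tmul]
    exact Finset.sum_comm
  exact DFunLike.congr_fun h b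

theorem chiBar_pow {K G : Type} [Field K] [Ring G] [Algebra K G] (t : ℕ) (dTi : G) :
    chiBar K G t dTi ^ t = alphaMap K G t dTi dTi := by
  rw [chiBar, ← map_pow]
  exact RingQuot.mkAlgHom_rel K ChiRel.rel

theorem chiBar_mul_alphaMap {K G : Type} [Field K] [Ring G] [Algebra K G] (t : ℕ) (dTi g : G) :
    chiBar K G t dTi * alphaMap K G t dTi g = alphaMap K G t dTi g * chiBar K G t dTi := by
  change RingQuot.mkAlgHom K _ _ * RingQuot.mkAlgHom K _ _ =
    RingQuot.mkAlgHom K _ _ * RingQuot.mkAlgHom K _ _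
  rw [← map_mul, ← map_mul]
  exact congrArg _ (Polynomial.X_mul_C g)

/-- (case `m = n > t`) with `φ*_q : O_q(GL_t) ⊗ O_q(K^×) → O_q(GL_t)[χ̄]`
(`T_{ij} ⊗ 1 ↦ T_{ij}χ̄`, `1 ⊗ T ↦ χ̄⁻¹ = d_T χ̄^{t-1}`) and the induced morphism
`φ̃*_q : O_q(SL_t) ⊗ O_q(K^×) → O_q(GL_t)[χ̄]`:
(a) `φ*_q ∘ (id ⊗ π') ∘ Δ = α_q`;
(b) `(φ̃*_q ⊗ id) ∘ (id ⊗ π' ⊗ id) ∘ (id ⊗ γ*_q) ∘ Γ*_q = (α_q ⊗ id) ∘ γ*_q`. -/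
theorem stmt16 (K : Type) [Field K] (q : K) (hq : q ≠ 0) (n t : ℕ) (ht : 0 < t) (htn : t < n)
    -- `G` is the Hopf algebra `O_q(GL_t)`, the localization of `O_q(M_t)` at the central
    -- quantum determinant `d_T`:
    (G : Type) [Ring G] [HopfAlgebra K G]
    (ιG : OqM K q t t →ₐ[K] G)
    (hcentral : ∀ g : G, ιG (qdet K q t) * g = g * ιG (qdet K q t))
    (hunit : IsUnit (ιG (qdet K q t)))
    (huniv : ∀ (C : Type) [Ring C] [Algebra K C] (f : OqM K q t t →ₐ[K] C),
      IsUnit (f (qdet K q t)) → ∃! g : G →ₐ[K] C, g.comp ιG = f)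
    -- the Hopf structure of `G` on the generators `T_{ij} = ιG X_{ij}`:
    (hΔT : ∀ i j : Fin t, Coalgebra.comul (R := K) (ιG (Xg K q i j)) =
      ∑ k : Fin t, ιG (Xg K q i k) ⊗ₜ[K] ιG (Xg K q k j))
    (hεT : ∀ i j : Fin t, Coalgebra.counit (R := K) (ιG (Xg K q i j)) =
      if i = j then (1 : K) else 0)
    -- `SL = O_q(SL_t) = O_q(GL_t)/⟨d_T - 1⟩`, with the quotient map `π`:
    (SL : Type) [Ring SL] [Algebra K SL] (π : G →ₐ[K] SL)
    (hπsurj : Function.Surjective π)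
    (hπker : ∀ g : G, π g = 0 ↔ g ∈ tsSpan K G {ιG (qdet K q t) - 1})
    -- the coactions `ρ*_q` (on `O_q(M_{n,t})`) and `λ*_q` (on `O_q(M_{t,n})`):
    (ρ : OqM K q n t →ₐ[K] OqM K q n t ⊗[K] G)
    (hρ : ∀ (i : Fin n) (j : Fin t),
      ρ (Xg K q i j) = ∑ k : Fin t, Xg K q i k ⊗ₜ[K] ιG (Xg K q k j))
    (lam : OqM K q t n →ₐ[K] G ⊗[K] OqM K q t n)
    (hlam : ∀ (i : Fin t) (j : Fin n),
      lam (Xg K q i j) = ∑ k : Fin t, ιG (Xg K q i k) ⊗ₜ[K] Xg K q k j)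
    -- the Hopf algebra morphism `π' : O_q(GL_t) → O_q(K^×) = K[T^{±1}]`:
    (π' : G →ₐ[K] LaurentPolynomial K)
    (hπ' : ∀ i j : Fin t,
      π' (ιG (Xg K q i j)) = if i = j then LaurentPolynomial.T 1 else 0)
    -- a two-sided inverse `d_T⁻¹` of `d_T` in `O_q(GL_t)`:
    (dTi : G) (hdTi : ιG (qdet K q t) * dTi = 1 ∧ dTi * ιG (qdet K q t) = 1)
    -- `φ*_q : O_q(GL_t) ⊗ O_q(K^×) → O_q(GL_t)[χ̄]`:
    (φ : G ⊗[K] LaurentPolynomial K →ₐ[K] RingQuot (ChiRel G t dTi))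
    (hφT : ∀ i j : Fin t,
      φ (ιG (Xg K q i j) ⊗ₜ[K] (1 : LaurentPolynomial K)) =
        alphaMap K G t dTi (ιG (Xg K q i j)) * chiBar K G t dTi)
    (hφL : φ ((1 : G) ⊗ₜ[K] LaurentPolynomial.T 1) =
      alphaMap K G t dTi (ιG (qdet K q t)) * chiBar K G t dTi ^ (t - 1))
    -- the induced morphism `φ̃*_q : O_q(SL_t) ⊗ O_q(K^×) → O_q(GL_t)[χ̄]`:
    (φt : SL ⊗[K] LaurentPolynomial K →ₐ[K] RingQuot (ChiRel G t dTi))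
    (hφt : φt.comp
        (Algebra.TensorProduct.map π (AlgHom.id K (LaurentPolynomial K))) = φ) :
    (∀ g : G,
        φ ((TensorProduct.map LinearMap.id π'.toLinearMap)
            (Coalgebra.comul (R := K) g)) = alphaMap K G t dTi g) ∧
    (∀ v : OqM K q n t ⊗[K] OqM K q t n,
        (TensorProduct.map φt.toLinearMap LinearMap.id)
          ((TensorProduct.assoc K SL (LaurentPolynomial K)
              (OqM K q n t ⊗[K] OqM K q t n)).symm
            ((TensorProduct.map LinearMap.id
                (TensorProduct.map π'.toLinearMap LinearMap.id))
              ((TensorProduct.map LinearMap.id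
                  (gammaMap K (OqM K q n t) (OqM K q t n) G ρ lam))
                ((TensorProduct.map π.toLinearMap LinearMap.id)
                  (gammaMap K (OqM K q n t) (OqM K q t n) G ρ lam v))))) =
          (TensorProduct.map (alphaMap K G t dTi).toLinearMap LinearMap.id)
            (gammaMap K (OqM K q n t) (OqM K q t n) G ρ lam v)) := by
  have ha : ∀ g : G, φ ((TensorProduct.map LinearMap.id π'.toLinearMap)
      (Coalgebra.comul (R := K) g)) = alphaMap K G t dTi g := by
    let F : G →ₐ[K] RingQuot (ChiRel G t dTi) :=
      (φ.comp (Algebra.TensorProduct.map (AlgHom.id K G) π')).comp (Bialgebra.comulAlgHom K G)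
    have hF : F.comp ιG = (alphaMap K G t dTi).comp ιG := by
      refine OqM.algHom_ext fun i j => ?_
      have h1 : F (ιG (Xg K q i j)) =
          φ (ιG (Xg K q i j) ⊗ₜ[K] LaurentPolynomial.T 1) := by
        simp only [F, AlgHom.comp_apply, Bialgebra.comulAlgHom_apply, hΔT, map_sum,
          Algebra.TensorProduct.map_tmul, hπ', AlgHom.id_apply]
        rw [Finset.sum_eq_single j] <;> simp +contextual
      have h2 : ιG (Xg K q i j) ⊗ₜ[K] (LaurentPolynomial.T 1 : LaurentPolynomial K) =
          (ιG (Xg K q i j) ⊗ₜ[K] 1) * ((1 : G) ⊗ₜ[K] LaurentPolynomial.T 1) := by simp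
      change F (ιG (Xg K q i j)) = alphaMap K G t dTi (ιG (Xg K q i j))
      rw [h1, h2, map_mul, hφT, hφL, mul_assoc,
        ← mul_assoc (chiBar K G t dTi), chiBar_mul_alphaMap, mul_assoc, ← pow_succ',
        Nat.sub_add_cancel ht, chiBar_pow, ← map_mul, hdTi.1, map_one, mul_one]
    have hFα : F = alphaMap K G t dTi :=
      (huniv _ ((alphaMap K G t dTi).comp ιG) (hunit.map (alphaMap K G t dTi))).unique hF rfl
    exact DFunLike.congr_fun hFα
  refine ⟨ha, fun v => ?_⟩
  have hφ (g : G) (x : LaurentPolynomial K) : φt (π g ⊗ₜ[K] x) = φ (g ⊗ₜ[K] x) := by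
    simp [← hφt]
  let V := OqM K q n t ⊗[K] OqM K q t n
  have hchain (u : G ⊗[K] (G ⊗[K] V)) :
      TensorProduct.map φt.toLinearMap LinearMap.id
        ((TensorProduct.assoc K SL (LaurentPolynomial K) V).symm
          (TensorProduct.map π.toLinearMap (TensorProduct.map π'.toLinearMap LinearMap.id) u)) =
      TensorProduct.map (φ.toLinearMap ∘ₗ TensorProduct.map LinearMap.id π'.toLinearMap)
        LinearMap.id ((TensorProduct.assoc K G G V).symm u) := by
    induction u using TensorProduct.induction_on with
    | zero => simp
    | add x y hx hy => simp only [map_add, hx, hy]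
    | tmul g z =>
      induction z using TensorProduct.induction_on with
      | zero => simp
      | add x y hx hy => simp only [TensorProduct.tmul_add, map_add, hx, hy]
      | tmul h w => simp [hφ]
  have hmaps (u : G ⊗[K] V) :
      TensorProduct.map LinearMap.id (TensorProduct.map π'.toLinearMap LinearMap.id)
        (TensorProduct.map LinearMap.id (gammaMap K (OqM K q n t) (OqM K q t n) G ρ lam)
          (TensorProduct.map π.toLinearMap LinearMap.id u)) =
      TensorProduct.map π.toLinearMap (TensorProduct.map π'.toLinearMap LinearMap.id)
        (TensorProduct.map LinearMap.id (gammaMap K (OqM K q n t) (OqM K q t n) G ρ lam) u) := by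
    simp only [← LinearMap.comp_apply, ← TensorProduct.map_comp, LinearMap.id_comp,
      LinearMap.comp_id]
  rw [hmaps, hchain, gammaMap_coassoc ρ lam (rightCoaction_coassoc hΔT hρ)
    (leftCoaction_coassoc hΔT hlam), LinearEquiv.symm_apply_apply, ← LinearMap.comp_apply,
    ← TensorProduct.map_comp, LinearMap.id_comp]
  congr 2
  exact LinearMap.ext ha

end
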